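/- arXiv:2410.21544 — 7 statements merged into one kernel-verified Lean document; each statement's English description precedes it below -/
import Mathlib

section
/- Let n ≥ 1, m ≥ 0, let θ_1,…,θ_n be real numbers and ζ_1,…,ζ_m complex numbers such that sin((θ_j−θ_k)/2) ≠ 0 for all j ≠ k, sin((ζ_k−ζ_l)/2) ≠ 0 for all k ≠ l, and sin((θ_j−ζ_l)/2) ≠ 0 for all j,l (sin and cot denote the complex sine and cotangent). Assume the angular stationary relations hold: for every k = 1,…,m, Σ_{j=1}^n cot((ζ_k−θ_j)/2) = 2 Σ_{l≠k} cot((ζ_k−ζ_l)/2). Define U_j = Σ_{k≠j} cot((θ_j−θ_k)/2) − 2 Σ_{l=1}^m cot((θ_j−ζ_l)/2). Then for every j = 1,…,n the null vector equation holds: (1/2)U_j^2 + Σ_{k≠j} cot((θ_k−θ_j)/2)·U_k − Σ_{k≠j} 3/(2 sin^2((θ_j−θ_k)/2)) = −(2m−n)^2/2 + 1/2. -/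
open Finset

/-- The complex cotangent. -/
noncomputable def ccot (w : ℂ) : ℂ := Complex.cos w / Complex.sin w

/-- The drift functions `U_j` of the multiple radial SLE(0) system in angular coordinates. -/
noncomputable def Ufn (n m : ℕ) (θ : Fin n → ℝ) (ζ : Fin m → ℂ) (j : Fin n) : ℂ :=
  (∑ k ∈ univ.filter (fun k => k ≠ j), ccot (((θ j : ℂ) - (θ k : ℂ)) / 2))
    - 2 * ∑ l, ccot (((θ j : ℂ) - ζ l) / 2)

theorem ccot_neg (w : ℂ) : ccot (-w) = -ccot w := by
  simp [ccot, div_neg]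

theorem ccot_half_sub_comm (x y : ℂ) : ccot ((x - y) / 2) = -ccot ((y - x) / 2) := by
  rw [← ccot_neg]; congr 1; ring

/-- The cotangent addition formula for the half-differences of three points. -/
theorem ccot_mul_add_ccot_mul {x y z : ℂ} (hxy : Complex.sin ((x - y) / 2) ≠ 0)
    (hxz : Complex.sin ((x - z) / 2) ≠ 0) (hyz : Complex.sin ((y - z) / 2) ≠ 0) :
    ccot ((x - y) / 2) * ccot ((y - z) / 2) + ccot ((x - z) / 2) * ccot ((z - y) / 2)
      = 1 + ccot ((x - y) / 2) * ccot ((x - z) / 2) := by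
  rw [ccot_half_sub_comm z y]
  have hx : (x - z) / 2 = (x - y) / 2 + (y - z) / 2 := by ring
  rw [hx] at hxz ⊢
  unfold ccot
  generalize (x - y) / 2 = u at *
  generalize (y - z) / 2 = v at *
  field_simp
  rw [Complex.sin_add, Complex.cos_add]
  ring

theorem ccot_sq {w : ℂ} (h : Complex.sin w ≠ 0) :
    1 / Complex.sin w ^ 2 = 1 + ccot w ^ 2 := by
  unfold ccot
  field_simp
  linear_combination -Complex.sin_sq_add_cos_sq w

/-- Symmetrization of a double sum whose symmetric part is `1 + b i * b k`. -/
theorem sum_mul_sum_filter_ne {ι : Type*} [DecidableEq ι] (s : Finset ι) (b : ι → ℂ)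
    (D : ι → ι → ℂ)
    (h : ∀ i ∈ s, ∀ k ∈ s, i ≠ k → b i * D i k + b k * D k i = 1 + b i * b k) :
    2 * ∑ i ∈ s, b i * ∑ k ∈ s with k ≠ i, D i k
      = (∑ i ∈ s, b i) ^ 2 - ∑ i ∈ s, b i ^ 2 + (#s : ℂ) * (#s - 1) := by
  have hL : ∑ i ∈ s, b i * ∑ k ∈ s with k ≠ i, D i k
      = ∑ i ∈ s, ∑ k ∈ s, if k ≠ i then b i * D i k else 0 := by
    simp only [mul_sum, sum_filter, mul_ite, mul_zero]
  have hR : ∑ i ∈ s, b i * ∑ k ∈ s with k ≠ i, D i k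
      = ∑ i ∈ s, ∑ k ∈ s, if k ≠ i then b k * D k i else 0 := by
    rw [hL, sum_comm]
    simp only [ne_comm]
  have hsum : ∀ i ∈ s, ∑ k ∈ s, ((if k ≠ i then b i * D i k else 0)
      + (if k ≠ i then b k * D k i else 0))
      = ((#s : ℂ) - 1) + b i * ∑ k ∈ s, b k - b i ^ 2 := by
    intro i hi
    have : ∀ k ∈ s, ((if k ≠ i then b i * D i k else 0) + (if k ≠ i then b k * D k i else 0))
        = (1 + b i * b k) - if k = i then 1 + b i * b k else 0 := by
      intro k hk
      by_cases hki : k = i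
      · simp [hki]
      · simpa [hki] using h i hi k hk (Ne.symm hki)
    rw [sum_congr rfl this, sum_sub_distrib, sum_ite_eq' s i, if_pos hi, sum_add_distrib,
      ← mul_sum]
    simp only [sum_const, nsmul_eq_mul, mul_one]
    ring
  rw [two_mul]
  nth_rw 1 [hL]
  rw [hR, ← sum_add_distrib]
  simp only [← sum_add_distrib]
  rw [sum_congr rfl hsum, sum_sub_distrib, sum_add_distrib, ← sum_mul]
  simp only [sum_const, nsmul_eq_mul]
  ring

theorem stmt2 (n m : ℕ) (hn : 1 ≤ n)
    (θ : Fin n → ℝ) (ζ : Fin m → ℂ)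
    (hθ : ∀ j k : Fin n, j ≠ k → Complex.sin (((θ j : ℂ) - (θ k : ℂ)) / 2) ≠ 0)
    (hζ : ∀ k l : Fin m, k ≠ l → Complex.sin ((ζ k - ζ l) / 2) ≠ 0)
    (hθζ : ∀ (j : Fin n) (l : Fin m), Complex.sin (((θ j : ℂ) - ζ l) / 2) ≠ 0)
    (hstat : ∀ k : Fin m,
      ∑ j, ccot ((ζ k - (θ j : ℂ)) / 2)
        = 2 * ∑ l ∈ univ.filter (fun l => l ≠ k), ccot ((ζ k - ζ l) / 2)) :
    ∀ j : Fin n,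
      (1 / 2) * (Ufn n m θ ζ j) ^ 2
        + ∑ k ∈ univ.filter (fun k => k ≠ j),
            ccot (((θ k : ℂ) - (θ j : ℂ)) / 2) * Ufn n m θ ζ k
        - ∑ k ∈ univ.filter (fun k => k ≠ j),
            3 / (2 * Complex.sin (((θ j : ℂ) - (θ k : ℂ)) / 2) ^ 2)
        = -(2 * (m : ℂ) - (n : ℂ)) ^ 2 / 2 + 1 / 2 := by
  intro j
  set s : Finset (Fin n) := univ.filter (fun k => k ≠ j) with hs
  set a : Fin n → ℂ := fun k => ccot (((θ j : ℂ) - θ k) / 2) with ha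
  set b : Fin m → ℂ := fun l => ccot (((θ j : ℂ) - ζ l) / 2) with hb
  have hne : ∀ k ∈ s, k ≠ j := fun k hk => (mem_filter.mp hk).2
  have hsplit : ∀ f : Fin n → ℂ, ∑ k, f k = f j + ∑ k ∈ s, f k := by
    intro f
    rw [hs, filter_ne', add_sum_erase _ _ (mem_univ j)]
  have hcard : (#s : ℂ) = n - 1 := by
    have := hsplit fun _ => 1
    simp only [sum_const, card_univ, Fintype.card_fin, nsmul_eq_mul, mul_one] at this
    rw [this]; ring
  have hθθ := sum_mul_sum_filter_ne s a (fun i k => ccot (((θ i : ℂ) - θ k) / 2))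
    fun i hi k hk hik => ccot_mul_add_ccot_mul (hθ j i (hne i hi).symm)
      (hθ j k (hne k hk).symm) (hθ i k hik)
  have hζζ := sum_mul_sum_filter_ne univ b (fun i k => ccot ((ζ i - ζ k) / 2))
    fun i _ k _ hik => ccot_mul_add_ccot_mul (hθζ j i) (hθζ j k) (hζ i k hik)
  -- the mixed interaction, moved from the `θ` side to the `ζ` side and evaluated there
  have hmixed : ∑ k ∈ s, a k * ∑ l, ccot (((θ k : ℂ) - ζ l) / 2)
      = (#s : ℂ) * m + (∑ k ∈ s, a k) * ∑ l, b l
        - ∑ l, b l * ∑ k ∈ s, ccot ((ζ l - θ k) / 2) := by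
    rw [sum_mul_sum]
    simp only [mul_sum]
    rw [sum_comm (s := univ) (t := s), eq_sub_iff_add_eq, ← sum_add_distrib]
    have : ∀ k ∈ s, (∑ l, a k * ccot (((θ k : ℂ) - ζ l) / 2))
        + ∑ l, b l * ccot ((ζ l - θ k) / 2) = m + ∑ l, a k * b l := by
      intro k hk
      rw [← sum_add_distrib, sum_congr rfl fun l _ => ccot_mul_add_ccot_mul
        (hθ j k (hne k hk).symm) (hθζ j l) (hθζ k l), sum_add_distrib]
      simp [ha, hb]
    rw [sum_congr rfl this, sum_add_distrib]
    simp
  have hstat' : ∀ l, ∑ k ∈ s, ccot ((ζ l - θ k) / 2)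
      = 2 * ∑ i ∈ univ.filter (fun i => i ≠ l), ccot ((ζ l - ζ i) / 2) + b l := by
    intro l
    have := hstat l
    rw [hsplit, ccot_half_sub_comm (ζ l) (θ j)] at this
    rw [← this]
    simp [hb]
  have hζsum : ∑ l, b l * ∑ k ∈ s, ccot ((ζ l - θ k) / 2)
      = 2 * ∑ l, b l * ∑ i ∈ univ.filter (fun i => i ≠ l), ccot ((ζ l - ζ i) / 2)
        + ∑ l, b l ^ 2 := by
    rw [mul_sum, ← sum_add_distrib]
    refine sum_congr rfl fun l _ => ?_
    rw [hstat']; ring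
  have hU : ∀ k ∈ s, ccot (((θ k : ℂ) - θ j) / 2) * Ufn n m θ ζ k
      = a k ^ 2 - a k * (∑ i ∈ s with i ≠ k, ccot (((θ k : ℂ) - θ i) / 2))
        + 2 * (a k * ∑ l, ccot (((θ k : ℂ) - ζ l) / 2)) := by
    intro k hk
    have hsum : ∑ i ∈ univ.filter (fun i => i ≠ k), ccot (((θ k : ℂ) - θ i) / 2)
        = -a k + ∑ i ∈ s with i ≠ k, ccot (((θ k : ℂ) - θ i) / 2) := by
      rw [sum_filter, hsplit, if_pos (hne k hk).symm, ← sum_filter,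
        ccot_half_sub_comm (θ k) (θ j)]
    rw [Ufn, hsum, ccot_half_sub_comm (θ k) (θ j)]
    change -a k * _ = _
    ring
  have hsin : ∑ k ∈ s, 3 / (2 * Complex.sin (((θ j : ℂ) - θ k) / 2) ^ 2)
      = 3 / 2 * (#s + ∑ k ∈ s, a k ^ 2) := by
    have : ∀ k ∈ s, 3 / (2 * Complex.sin (((θ j : ℂ) - θ k) / 2) ^ 2)
        = 3 / 2 * (1 + a k ^ 2) := by
      intro k hk
      rw [← ccot_sq (hθ j k (hne k hk).symm), div_mul_div_comm, mul_one]
    rw [sum_congr rfl this, ← mul_sum, sum_add_distrib]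
    simp
  have hUj : Ufn n m θ ζ j = ∑ k ∈ s, a k - 2 * ∑ l, b l := rfl
  rw [sum_congr rfl hU, sum_add_distrib, sum_sub_distrib, ← mul_sum, hsin, hUj, hmixed, hζsum,
    hcard]
  rw [hcard] at hθθ
  rw [card_univ, Fintype.card_fin] at hζζ
  linear_combination -(1 / 2) * hθθ - 2 * hζζ
end

section
/- Let θ_1,…,θ_n be real numbers and ζ_1,…,ζ_m complex numbers such that sin((θ_j−θ_k)/2) ≠ 0 for all j ≠ k, sin((ζ_s−ζ_t)/2) ≠ 0 for all s ≠ t, and sin((θ_k−ζ_l)/2) ≠ 0 for all k,l. Assume the list (ζ_1,…,ζ_m) is closed under complex conjugation, i.e. there is an involutive permutation σ of {1,…,m} with ζ_{σ(l)} equal to the complex conjugate of ζ_l for every l. Then the complex number Z = ∏_{1≤j<k≤n} sin((θ_j−θ_k)/2)^2 · ∏_{1≤s<t≤m} sin((ζ_s−ζ_t)/2)^8 · ∏_{k=1}^n∏_{l=1}^m sin((θ_k−ζ_l)/2)^{−4} is a strictly positive real number. -/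
open Finset

theorem exists_ofReal_ne_zero_of_conj_eq {z : ℂ} (hz : (starRingEnd ℂ) z = z) (h0 : z ≠ 0) :
    ∃ r : ℝ, r ≠ 0 ∧ z = (r : ℂ) := by
  obtain ⟨r, rfl⟩ := Complex.conj_eq_iff_real.1 hz
  exact ⟨r, by simpa using h0, rfl⟩

/-- For antisymmetric `f`, the eighth powers over increasing pairs multiply to the fourth power of
the product of `f` over all ordered pairs of distinct indices. -/
theorem prod_filter_lt_pow_eight {ι R : Type*} [Fintype ι] [LinearOrder ι] [CommRing R]
    (f : ι → ι → R) (hf : ∀ s t, f t s = -f s t) :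
    ∏ s, ∏ t ∈ univ.filter (fun t => s < t), f s t ^ 8 =
      (∏ s, ∏ t, if s = t then 1 else f s t) ^ 4 := by
  have key : ∀ s t, (if s = t then (1 : R) else f s t) ^ 4 =
      (if s < t then f s t ^ 4 else 1) * (if t < s then f t s ^ 4 else 1) := by
    intro s t
    rcases lt_trichotomy s t with h | rfl | h
    · simp [h, h.ne, h.le]
    · simp
    · simp [h, h.ne', h.le, hf s t, (by decide : Even 4).neg_pow]
  simp_rw [← prod_pow, key, prod_mul_distrib]
  rw [prod_comm (f := fun s t => if t < s then f t s ^ 4 else 1)]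
  simp_rw [← prod_mul_distrib, prod_filter]
  refine prod_congr rfl fun s _ => prod_congr rfl fun t _ => ?_
  split_ifs <;> ring

theorem stmt5 (n m : ℕ)
    (θ : Fin n → ℝ) (ζ : Fin m → ℂ)
    (hθ : ∀ j k : Fin n, j ≠ k → Complex.sin (((θ j : ℂ) - (θ k : ℂ)) / 2) ≠ 0)
    (hζ : ∀ s t : Fin m, s ≠ t → Complex.sin ((ζ s - ζ t) / 2) ≠ 0)
    (hθζ : ∀ (k : Fin n) (l : Fin m), Complex.sin (((θ k : ℂ) - ζ l) / 2) ≠ 0)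
    (σ : Fin m → Fin m) (hσ : Function.Involutive σ)
    (hconj : ∀ l, ζ (σ l) = (starRingEnd ℂ) (ζ l)) :
    ∃ r : ℝ, 0 < r ∧
      (∏ j, ∏ k ∈ univ.filter (fun k => j < k),
          Complex.sin (((θ j : ℂ) - (θ k : ℂ)) / 2) ^ 2) *
      (∏ s, ∏ t ∈ univ.filter (fun t => s < t),
          Complex.sin ((ζ s - ζ t) / 2) ^ 8) *
      (∏ k, ∏ l, Complex.sin (((θ k : ℂ) - ζ l) / 2) ^ (-4 : ℤ)) = (r : ℂ) := by
  obtain ⟨b, hb0, hb⟩ := exists_ofReal_ne_zero_of_conj_eq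
    (z := ∏ s, ∏ t, if s = t then 1 else Complex.sin ((ζ s - ζ t) / 2))
    (by
      simp only [map_prod]
      refine Fintype.prod_bijective σ hσ.bijective _ _ fun s => ?_
      refine Fintype.prod_bijective σ hσ.bijective _ _ fun t => ?_
      simp only [hσ.injective.eq_iff, hconj]
      split_ifs <;> simp [← Complex.sin_conj, map_ofNat])
    (by
      refine prod_ne_zero_iff.2 fun s _ => prod_ne_zero_iff.2 fun t _ => ?_
      split_ifs with h
      · exact one_ne_zero
      · exact hζ s t h)
  have hc : ∀ k, ∃ r : ℝ, r ≠ 0 ∧ ∏ l, Complex.sin (((θ k : ℂ) - ζ l) / 2) = (r : ℂ) := by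
    intro k
    refine exists_ofReal_ne_zero_of_conj_eq ?_ (prod_ne_zero_iff.2 fun l _ => hθζ k l)
    rw [map_prod]
    refine Fintype.prod_bijective σ hσ.bijective _ _ fun l => ?_
    simp [← Complex.sin_conj, map_ofNat, hconj]
  choose c hc0 hc using hc
  refine ⟨(∏ j, ∏ k ∈ univ.filter (fun k => j < k), Real.sin ((θ j - θ k) / 2) ^ 2) * b ^ 4 *
    ∏ k, c k ^ (-4 : ℤ), ?_, ?_⟩
  · refine mul_pos (mul_pos ?_ ((by decide : Even 4).pow_pos hb0)) ?_
    · refine prod_pos fun j _ => prod_pos fun k hk => sq_pos_of_ne_zero fun h => ?_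
      refine hθ j k (mem_filter.1 hk).2.ne ?_
      exact_mod_cast congrArg Complex.ofReal h
    · exact prod_pos fun k _ => (by decide : Even (-4 : ℤ)).zpow_pos (hc0 k)
  · rw [prod_filter_lt_pow_eight (fun s t => Complex.sin ((ζ s - ζ t) / 2))
      (fun s t => by rw [← Complex.sin_neg]; ring_nf), hb]
    simp_rw [prod_zpow, hc]
    push_cast
    rfl
end

section
/- Let n ≥ 1 and let θ_1,…,θ_n be real numbers with sin((θ_j−θ_k)/2) ≠ 0 for all j ≠ k. Then Σ_{j=1}^n ( Σ_{k≠j} cot((θ_j−θ_k)/2) )^2 = Σ_{j=1}^n Σ_{k≠j} 1/sin^2((θ_j−θ_k)/2) − n(n^2−1)/3. -/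
open Finset

/-- The three-term cotangent identity for three angles with sum zero. -/
theorem cos_div_sin_three_term {x y : ℝ} (hx : Real.sin x ≠ 0) (hy : Real.sin y ≠ 0)
    (hxy : Real.sin (x + y) ≠ 0) :
    Real.cos x / Real.sin x * (Real.cos (x + y) / Real.sin (x + y))
      - Real.cos x / Real.sin x * (Real.cos y / Real.sin y)
      + Real.cos (x + y) / Real.sin (x + y) * (Real.cos y / Real.sin y) = -1 := by
  field_simp
  rw [Real.sin_add, Real.cos_add]
  ring

/-- If `c` satisfies a symmetric three-term relation with off-diagonal part `-1` and diagonal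
corrections `s`, then the sum of its squared row sums is determined by the sum of `s`. -/
theorem sum_sq_row_sum_of_three_term {ι : Type*} [Fintype ι] [DecidableEq ι] (c s : ι → ι → ℝ)
    (h : ∀ j k l, c j k * c j l + c k j * c k l + c l j * c l k
      = -1 + (if k = l then s j k else 0) + (if j = k then s k l else 0)
        + (if j = l then s j k else 0) + (if j = k then if k = l then 1 else 0 else 0)) :
    ∑ j, (∑ k, c j k) ^ 2
      = ∑ j, ∑ k, s j k
        - (Fintype.card ι : ℝ) * ((Fintype.card ι : ℝ) ^ 2 - 1) / 3 := by
  have row : ∑ j, (∑ k, c j k) ^ 2 = ∑ j, ∑ k, ∑ l, c j k * c j l := by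
    simp_rw [sq, sum_mul_sum]
  have h₂ : ∑ j, ∑ k, ∑ l, c k j * c k l = ∑ j, ∑ k, ∑ l, c j k * c j l := sum_comm
  have h₃ : ∑ j, ∑ k, ∑ l, c l j * c l k = ∑ j, ∑ k, ∑ l, c j k * c j l := by
    rw [sum_congr rfl fun j _ => sum_comm, sum_comm]
  have hs : ∑ j, ∑ k, ∑ l, (c j k * c j l + c k j * c k l + c l j * c l k)
      = -(Fintype.card ι : ℝ) ^ 3 + 3 * ∑ j, ∑ k, s j k + Fintype.card ι := by
    simp_rw [h, sum_add_distrib]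
    have e : ∀ j : ι, ∑ k, ∑ l, (if j = k then s k l else 0) = ∑ l, s j l := by
      intro j
      rw [sum_comm]
      simp
    have e' : ∀ j : ι, ∑ k, ∑ l, (if j = k then if k = l then (1 : ℝ) else 0 else 0) = 1 := by
      intro j
      rw [sum_comm]
      simp
    simp only [e, e', sum_ite_eq, mem_univ, if_true, sum_const, card_univ, nsmul_eq_mul]
    ring
  simp_rw [sum_add_distrib] at hs
  rw [h₂, h₃] at hs
  rw [row]
  linarith

theorem stmt6 (n : ℕ) (hn : 1 ≤ n) (θ : Fin n → ℝ)
    (hθ : ∀ j k : Fin n, j ≠ k → Real.sin ((θ j - θ k) / 2) ≠ 0) :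
    ∑ j, (∑ k ∈ univ.filter (fun k => k ≠ j),
        Real.cos ((θ j - θ k) / 2) / Real.sin ((θ j - θ k) / 2)) ^ 2
      = (∑ j, ∑ k ∈ univ.filter (fun k => k ≠ j),
          1 / Real.sin ((θ j - θ k) / 2) ^ 2)
        - (n : ℝ) * ((n : ℝ) ^ 2 - 1) / 3 := by
  have drop : ∀ (f : Fin n → Fin n → ℝ), (∀ j, f j j = 0) →
      ∀ j, ∑ k ∈ univ.filter (fun k => k ≠ j), f j k = ∑ k, f j k := by
    intro f hf j
    refine sum_filter_of_ne fun k _ hk hkj => hk ?_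
    rw [hkj, hf]
  simp_rw [drop (fun j k => Real.cos ((θ j - θ k) / 2) / Real.sin ((θ j - θ k) / 2)) (by simp),
    drop (fun j k => 1 / Real.sin ((θ j - θ k) / 2) ^ 2) (by simp)]
  have neg : ∀ j k, (θ k - θ j) / 2 = -((θ j - θ k) / 2) := fun j k => by ring
  have sq_cot : ∀ j k, j ≠ k →
      Real.cos ((θ j - θ k) / 2) / Real.sin ((θ j - θ k) / 2)
        * (Real.cos ((θ j - θ k) / 2) / Real.sin ((θ j - θ k) / 2))
      = -1 + 1 / Real.sin ((θ j - θ k) / 2) ^ 2 := by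
    intro j k hjk
    have := hθ j k hjk
    field_simp
    linarith [Real.sin_sq_add_cos_sq ((θ j - θ k) / 2)]
  have key := sum_sq_row_sum_of_three_term
    (fun j k => Real.cos ((θ j - θ k) / 2) / Real.sin ((θ j - θ k) / 2))
    (fun j k => 1 / Real.sin ((θ j - θ k) / 2) ^ 2) ?_
  · simpa only [Fintype.card_fin] using key
  intro j k l
  by_cases hjk : j = k
  · subst hjk
    by_cases hjl : j = l
    · subst hjl
      simp
    · have := sq_cot j l hjl
      rw [neg j l]
      simp [hjl] at this ⊢
      linarith
  by_cases hkl : k = l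
  · subst hkl
    have := sq_cot j k hjk
    simp [hjk] at this ⊢
    linarith
  by_cases hjl : j = l
  · subst hjl
    have := sq_cot k j hkl
    rw [neg k j]
    simp [hjk, hkl] at this ⊢
    linarith
  have hadd : (θ j - θ k) / 2 + (θ k - θ l) / 2 = (θ j - θ l) / 2 := by ring
  have := cos_div_sin_three_term (hθ j k hjk) (hθ k l hkl) (hadd ▸ hθ j l hjl)
  rw [hadd] at this
  simp only [hjk, hkl, hjl, if_false]
  rw [neg j k, neg j l, neg k l]
  simp only [Real.sin_neg, Real.cos_neg, div_neg]
  linarith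
end

section
/- Fix κ > 0 and n ≥ 1. For a twice continuously differentiable function ψ on the chamber 𝔜^n = {θ ∈ ℝ^n : θ_1 < θ_2 < … < θ_n < θ_1 + 2π}, define for each j the null vector operator (𝓛_j ψ)(θ) = (κ/2)·∂^2ψ/∂θ_j^2 + Σ_{k≠j} [ cot((θ_k−θ_j)/2)·∂ψ/∂θ_k − ((6−κ)/(2κ))·ψ(θ)/(2 sin^2((θ_k−θ_j)/2)) ], and let 𝓛 = Σ_{j=1}^n 𝓛_j. Let Φ(θ) = ∏_{1≤j<k≤n} |sin((θ_j−θ_k)/2)|^{−2/κ}. Then for every twice continuously differentiable ψ : 𝔜^n → ℝ and every θ ∈ 𝔜^n, 𝓛(Φ·ψ)(θ) = Φ(θ)·( κ·(H ψ)(θ) + (n(n^2−1)/(6κ))·ψ(θ) ), where H is the Calogero–Sutherland operator (H ψ)(θ) = Σ_{j=1}^n (1/2)∂^2ψ/∂θ_j^2 − (β(β−2)/16)·Σ_{1≤j<k≤n} ψ(θ)/sin^2((θ_j−θ_k)/2) with β = 8/κ. -/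
open Finset

/-- The angular chamber `𝔜^n = {θ : θ_1 < θ_2 < … < θ_n < θ_1 + 2π}`. -/
def chamber (n : ℕ) : Set (Fin n → ℝ) :=
  {θ | StrictMono θ ∧ ∀ i j : Fin n, θ i < θ j + 2 * Real.pi}

/-- Partial derivative in the `j`-th coordinate direction. -/
noncomputable def pd (n : ℕ) (j : Fin n) (ψ : (Fin n → ℝ) → ℝ) (θ : Fin n → ℝ) : ℝ :=
  fderiv ℝ ψ θ (Pi.single j 1 : Fin n → ℝ)

/-- The null vector operator `𝓛_j`. -/
noncomputable def Lop (n : ℕ) (κ : ℝ) (j : Fin n) (ψ : (Fin n → ℝ) → ℝ)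
    (θ : Fin n → ℝ) : ℝ :=
  κ / 2 * pd n j (pd n j ψ) θ
    + ∑ k ∈ univ.filter (fun k => k ≠ j),
        (Real.cos ((θ k - θ j) / 2) / Real.sin ((θ k - θ j) / 2) * pd n k ψ θ
          - (6 - κ) / (2 * κ) * ψ θ / (2 * Real.sin ((θ k - θ j) / 2) ^ 2))

/-- The function `Φ(θ) = ∏_{j<k} |sin((θ_j−θ_k)/2)|^{−2/κ}`. -/
noncomputable def PhiCS (n : ℕ) (κ : ℝ) (θ : Fin n → ℝ) : ℝ :=
  ∏ j, ∏ k ∈ univ.filter (fun k => j < k),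
    |Real.sin ((θ j - θ k) / 2)| ^ (-2 / κ)

/-- The Calogero–Sutherland operator with coupling `β`. -/
noncomputable def Hcs (n : ℕ) (β : ℝ) (ψ : (Fin n → ℝ) → ℝ) (θ : Fin n → ℝ) : ℝ :=
  (∑ j, (1 / 2) * pd n j (pd n j ψ) θ)
    - β * (β - 2) / 16 *
        ∑ j, ∑ k ∈ univ.filter (fun k => j < k),
          ψ θ / Real.sin ((θ j - θ k) / 2) ^ 2

open Real Topology

/-- The chamber is open. -/
theorem isOpen_chamber (n : ℕ) : IsOpen (chamber n) := by
  have h : chamber n = (⋂ i : Fin n, ⋂ j : Fin n, ⋂ _ : i < j, {θ | θ i < θ j}) ∩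
      ⋂ i : Fin n, ⋂ j : Fin n, {θ | θ i < θ j + 2 * Real.pi} := by
    ext θ
    simp only [chamber, Set.mem_ofPred_eq, Set.mem_inter_iff, Set.mem_iInter, StrictMono]
  rw [h]
  refine IsOpen.inter ?_ ?_
  · refine isOpen_iInter_of_finite fun i => isOpen_iInter_of_finite fun j =>
      isOpen_iInter_of_finite fun _ => ?_
    exact isOpen_lt (by fun_prop) (by fun_prop)
  · refine isOpen_iInter_of_finite fun i => isOpen_iInter_of_finite fun j => ?_
    exact isOpen_lt (by fun_prop) (by fun_prop)

theorem sin_half_sub_ne_zero {n : ℕ} {θ : Fin n → ℝ} (hθ : θ ∈ chamber n) {j k : Fin n}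
    (hjk : j ≠ k) : sin ((θ j - θ k) / 2) ≠ 0 := by
  obtain ⟨hm, hb⟩ := hθ
  rcases lt_or_gt_of_ne hjk with h | h
  · have h1 := hm h
    have h2 := hb k j
    exact (sin_neg_of_neg_of_neg_pi_lt (by linarith) (by linarith)).ne
  · have h1 := hm h
    have h2 := hb j k
    exact ne_of_gt (sin_pos_of_pos_of_lt_pi (by linarith) (by linarith))

/-- The half-angle cotangent `cot((θ_j - θ_k)/2)`; it vanishes on the diagonal. -/
noncomputable def halfCot {n : ℕ} (θ : Fin n → ℝ) (j k : Fin n) : ℝ :=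
  cos ((θ j - θ k) / 2) / sin ((θ j - θ k) / 2)

/-- The inverse square `1 / sin²((θ_j - θ_k)/2)`; it vanishes on the diagonal. -/
noncomputable def invSinSq {n : ℕ} (θ : Fin n → ℝ) (j k : Fin n) : ℝ :=
  1 / sin ((θ j - θ k) / 2) ^ 2

section HalfAngle

variable {n : ℕ} (θ : Fin n → ℝ)

@[simp] theorem halfCot_self (j : Fin n) : halfCot θ j j = 0 := by simp [halfCot]

@[simp] theorem invSinSq_self (j : Fin n) : invSinSq θ j j = 0 := by simp [invSinSq]

theorem sin_half_sub_comm (j k : Fin n) :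
    sin ((θ k - θ j) / 2) = -sin ((θ j - θ k) / 2) := by
  rw [← sin_neg]; congr 1; ring

theorem halfCot_comm (j k : Fin n) : halfCot θ k j = -halfCot θ j k := by
  have hc : cos ((θ k - θ j) / 2) = cos ((θ j - θ k) / 2) := by
    rw [← cos_neg]; congr 1; ring
  rw [halfCot, halfCot, hc, sin_half_sub_comm, div_neg]

theorem invSinSq_comm (j k : Fin n) : invSinSq θ k j = invSinSq θ j k := by
  rw [invSinSq, invSinSq, sin_half_sub_comm, neg_sq]

variable {θ}

theorem halfCot_sq (hθ : θ ∈ chamber n) {j k : Fin n} (hjk : j ≠ k) :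
    halfCot θ j k ^ 2 = invSinSq θ j k - 1 := by
  have h := sin_half_sub_ne_zero hθ hjk
  rw [halfCot, invSinSq, div_pow, cos_sq']
  field_simp

/-- The addition theorem of the cotangent for three angles that sum to zero. -/
theorem halfCot_cyclic (hθ : θ ∈ chamber n) {j k l : Fin n} (hjk : j ≠ k) (hkl : k ≠ l)
    (hjl : j ≠ l) :
    halfCot θ j k * halfCot θ j l + halfCot θ k j * halfCot θ k l
      + halfCot θ l j * halfCot θ l k = -1 := by
  rw [halfCot_comm θ j k, halfCot_comm θ j l, halfCot_comm θ k l]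
  have h1 := sin_half_sub_ne_zero hθ hjk
  have h2 := sin_half_sub_ne_zero hθ hkl
  have h3 := sin_half_sub_ne_zero hθ hjl
  have e : (θ j - θ l) / 2 = (θ j - θ k) / 2 + (θ k - θ l) / 2 := by ring
  simp only [halfCot]
  rw [e] at h3 ⊢
  generalize (θ j - θ k) / 2 = a at *
  generalize (θ k - θ l) / 2 = b at *
  field_simp
  rw [sin_add, cos_add]
  ring

/-- The sum over `j` of the squares of `∑ k, cot((θ_j - θ_k)/2)`. -/
theorem sum_sq_sum_halfCot (hθ : θ ∈ chamber n) :
    ∑ j, (∑ k, halfCot θ j k) ^ 2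
      = (∑ j, ∑ k, invSinSq θ j k) - (n : ℝ) * ((n : ℝ) ^ 2 - 1) / 3 := by
  have hpt : ∀ j k l : Fin n,
      halfCot θ j k * halfCot θ j l + halfCot θ k j * halfCot θ k l
        + halfCot θ l j * halfCot θ l k
      = -1 + (if j = k then invSinSq θ j l else 0) + (if k = l then invSinSq θ j k else 0)
        + (if j = l then invSinSq θ j k else 0) + (if k = l then if j = k then 1 else 0 else 0) := by
    intro j k l
    by_cases hjk : j = k
    · subst hjk
      by_cases hjl : j = l
      · subst hjl; simp
      · have := halfCot_sq hθ hjl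
        simp only [halfCot_self, halfCot_comm θ j l, hjl, if_true, if_false]
        linarith
    · have := halfCot_sq hθ hjk
      by_cases hkl : k = l
      · subst hkl
        simp only [halfCot_self, halfCot_comm θ j k, hjk, if_true, if_false]
        linarith
      · by_cases hjl : j = l
        · subst hjl
          simp only [halfCot_self, halfCot_comm θ j k, hjk, hkl, if_true, if_false]
          linarith
        · simp only [halfCot_cyclic hθ hjk hkl hjl, hjk, hkl, hjl, if_false]
          ring
  have hT : ∑ j, (∑ k, halfCot θ j k) ^ 2 = ∑ j, ∑ k, ∑ l, halfCot θ j k * halfCot θ j l := by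
    simp only [sq, sum_mul_sum]
  have hT2 : ∑ j, ∑ k, ∑ l, halfCot θ k j * halfCot θ k l
      = ∑ j, ∑ k, ∑ l, halfCot θ j k * halfCot θ j l := sum_comm
  have hT3 : ∑ j, ∑ k, ∑ l, halfCot θ l j * halfCot θ l k
      = ∑ j, ∑ k, ∑ l, halfCot θ j k * halfCot θ j l := by
    rw [← hT2]
    exact sum_congr rfl fun j _ => sum_comm
  have hsum := sum_congr rfl fun (j : Fin n) (_ : j ∈ univ) => sum_congr rfl
    fun (k : Fin n) (_ : k ∈ univ) => sum_congr rfl fun (l : Fin n) (_ : l ∈ univ) => hpt j k l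
  simp only [sum_add_distrib] at hsum
  rw [hT2, hT3, ← hT] at hsum
  have h1 : ∑ j : Fin n, ∑ k : Fin n, ∑ l : Fin n, (if j = k then invSinSq θ j l else 0)
      = ∑ j, ∑ k, invSinSq θ j k := by
    refine sum_congr rfl fun j _ => ?_
    rw [sum_comm]
    simp
  rw [h1] at hsum
  simp only [sum_const, card_univ, Fintype.card_fin, sum_ite_eq, mem_univ, if_true,
    nsmul_eq_mul, mul_one, mul_neg] at hsum
  linarith

end HalfAngle

section PartialDerivatives

variable {n : ℕ} {θ : Fin n → ℝ}

theorem HasFDerivAt.pd_eq {f : (Fin n → ℝ) → ℝ} {f' : (Fin n → ℝ) →L[ℝ] ℝ}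
    (h : HasFDerivAt f f' θ) (l : Fin n) : pd n l f θ = f' (Pi.single l 1) := by
  rw [pd, h.fderiv]

theorem pd_mul {f g : (Fin n → ℝ) → ℝ} (hf : DifferentiableAt ℝ f θ)
    (hg : DifferentiableAt ℝ g θ) (l : Fin n) :
    pd n l (fun t => f t * g t) θ = pd n l f θ * g θ + f θ * pd n l g θ := by
  rw [(hf.hasFDerivAt.fun_mul hg.hasFDerivAt).pd_eq l]
  simp [pd]
  ring

theorem pd_add {f g : (Fin n → ℝ) → ℝ} (hf : DifferentiableAt ℝ f θ)
    (hg : DifferentiableAt ℝ g θ) (l : Fin n) :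
    pd n l (fun t => f t + g t) θ = pd n l f θ + pd n l g θ := by
  rw [(hf.hasFDerivAt.fun_add hg.hasFDerivAt).pd_eq l]
  simp [pd]

theorem pd_congr {f g : (Fin n → ℝ) → ℝ} (h : f =ᶠ[𝓝 θ] g) (l : Fin n) :
    pd n l f θ = pd n l g θ := by
  rw [pd, pd, h.fderiv_eq]

theorem differentiableAt_pd {ψ : (Fin n → ℝ) → ℝ} (hψ : ContDiffAt ℝ 2 ψ θ) (l : Fin n) :
    DifferentiableAt ℝ (pd n l ψ) θ := by
  have h : ContDiffAt ℝ 1 (fderiv ℝ ψ) θ := hψ.fderiv_right (by norm_num)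
  exact (h.differentiableAt one_ne_zero).clm_apply (differentiableAt_const _)

/-- The differential of `(θ_j - θ_k)/2`. -/
noncomputable def halfSubCLM (j k : Fin n) : (Fin n → ℝ) →L[ℝ] ℝ :=
  (1 / 2 : ℝ) • (ContinuousLinearMap.proj (R := ℝ) (φ := fun _ : Fin n => ℝ) j
    - ContinuousLinearMap.proj (R := ℝ) (φ := fun _ : Fin n => ℝ) k)

theorem halfSubCLM_apply (j k : Fin n) (v : Fin n → ℝ) :
    halfSubCLM j k v = (v j - v k) / 2 := by
  simp [halfSubCLM]
  ring

theorem hasFDerivAt_half_sub (j k : Fin n) :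
    HasFDerivAt (fun t : Fin n → ℝ => (t j - t k) / 2) (halfSubCLM j k) θ := by
  have h : (fun t : Fin n → ℝ => (t j - t k) / 2) = halfSubCLM j k := by
    ext t
    rw [halfSubCLM_apply]
  rw [h]
  exact (halfSubCLM j k).hasFDerivAt

theorem hasFDerivAt_log_sin (hθ : θ ∈ chamber n) (j k : Fin n) :
    HasFDerivAt (fun t : Fin n → ℝ => log (sin ((t j - t k) / 2)))
      (halfCot θ j k • halfSubCLM j k) θ := by
  by_cases hjk : j = k
  · subst hjk
    simpa using hasFDerivAt_const (0 : ℝ) θ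
  · have h := ((hasDerivAt_sin ((θ j - θ k) / 2)).log
      (sin_half_sub_ne_zero hθ hjk)).comp_hasFDerivAt θ (hasFDerivAt_half_sub j k)
    exact h

theorem hasFDerivAt_halfCot (hθ : θ ∈ chamber n) (j k : Fin n) :
    HasFDerivAt (fun t : Fin n → ℝ => halfCot t j k)
      ((-invSinSq θ j k) • halfSubCLM j k) θ := by
  by_cases hjk : j = k
  · subst hjk
    simpa using hasFDerivAt_const (0 : ℝ) θ
  · have h0 := sin_half_sub_ne_zero hθ hjk
    have h := ((hasDerivAt_cos ((θ j - θ k) / 2)).div (hasDerivAt_sin _)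
      h0).comp_hasFDerivAt θ (hasFDerivAt_half_sub j k)
    have e : -invSinSq θ j k
        = (-sin ((θ j - θ k) / 2) * sin ((θ j - θ k) / 2)
          - cos ((θ j - θ k) / 2) * cos ((θ j - θ k) / 2)) / sin ((θ j - θ k) / 2) ^ 2 := by
      rw [invSinSq, ← neg_div]
      congr 1
      linarith [sin_sq_add_cos_sq ((θ j - θ k) / 2)]
    rw [e]
    exact h

theorem hasFDerivAt_sum_halfCot (hθ : θ ∈ chamber n) (l : Fin n) :
    HasFDerivAt (fun t : Fin n → ℝ => ∑ k, halfCot t l k)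
      (∑ k, (-invSinSq θ l k) • halfSubCLM l k) θ :=
  HasFDerivAt.fun_sum fun k _ => hasFDerivAt_halfCot hθ l k

theorem pd_sum_halfCot (hθ : θ ∈ chamber n) (l : Fin n) :
    pd n l (fun t => ∑ k, halfCot t l k) θ = -(1 / 2) * ∑ k, invSinSq θ l k := by
  rw [(hasFDerivAt_sum_halfCot hθ l).pd_eq, _root_.sum_apply, mul_sum]
  refine sum_congr rfl fun k _ => ?_
  by_cases h : k = l
  · subst h; simp
  · simp [halfSubCLM_apply, h]
    ring

end PartialDerivatives

/-- A symmetric double sum without diagonal terms is twice its upper triangular part. -/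
theorem sum_sum_eq_two_mul_sum_lt {n : ℕ} (f : Fin n → Fin n → ℝ) (hs : ∀ j k, f k j = f j k)
    (hd : ∀ j, f j j = 0) :
    ∑ j, ∑ k, f j k = 2 * ∑ j, ∑ k ∈ univ.filter (fun k => j < k), f j k := by
  have h : ∑ j, ∑ k, f j k = ∑ j, ∑ k, ((if j < k then f j k else 0)
      + if k < j then f k j else 0) := by
    refine sum_congr rfl fun j _ => sum_congr rfl fun k _ => ?_
    rcases lt_trichotomy j k with h | h | h
    · simp [h, h.not_gt]
    · subst h; simp [hd]
    · simp [h, h.not_gt, hs k j]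
  simp only [h, sum_add_distrib, sum_filter]
  rw [sum_comm (f := fun j k => if k < j then f k j else 0)]
  ring

section Phi

variable {n : ℕ} {θ : Fin n → ℝ}

theorem PhiCS_eq_exp (κ : ℝ) (hθ : θ ∈ chamber n) :
    PhiCS n κ θ = exp (-1 / κ * ∑ j, ∑ k, log (sin ((θ j - θ k) / 2))) := by
  rw [sum_sum_eq_two_mul_sum_lt _ (fun j k => by rw [sin_half_sub_comm, log_neg_eq_log])
    (fun j => by simp), PhiCS, ← mul_assoc, mul_sum, exp_sum]
  refine prod_congr rfl fun j _ => ?_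
  rw [mul_sum, exp_sum]
  refine prod_congr rfl fun k hk => ?_
  have hjk : j ≠ k := (mem_filter.mp hk).2.ne
  rw [rpow_def_of_pos (abs_pos.mpr (sin_half_sub_ne_zero hθ hjk)), log_abs]
  congr 1
  ring

theorem hasFDerivAt_PhiCS (κ : ℝ) (hθ : θ ∈ chamber n) :
    HasFDerivAt (PhiCS n κ)
      (PhiCS n κ θ • (-1 / κ) • ∑ j, ∑ k, halfCot θ j k • halfSubCLM j k) θ := by
  have h := ((HasFDerivAt.fun_sum fun j (_ : j ∈ univ) => HasFDerivAt.fun_sum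
    fun k (_ : k ∈ univ) => hasFDerivAt_log_sin hθ j k).const_mul (-1 / κ)).exp
  rw [← PhiCS_eq_exp κ hθ] at h
  refine h.congr_of_eventuallyEq ?_
  filter_upwards [(isOpen_chamber n).mem_nhds hθ] with t ht using PhiCS_eq_exp κ ht

theorem pd_PhiCS (κ : ℝ) (hθ : θ ∈ chamber n) (l : Fin n) :
    pd n l (PhiCS n κ) θ = PhiCS n κ θ * (-1 / κ * ∑ k, halfCot θ l k) := by
  rw [(hasFDerivAt_PhiCS κ hθ).pd_eq]
  have h : ∑ j, ∑ k, halfCot θ j k * halfSubCLM j k (Pi.single l 1) = ∑ k, halfCot θ l k := by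
    have h1 : ∀ j k, halfCot θ j k * halfSubCLM j k (Pi.single l 1)
        = (if j = l then halfCot θ j k / 2 else 0) + if k = l then halfCot θ k j / 2 else 0 := by
      intro j k
      rw [halfSubCLM_apply, halfCot_comm θ j k, Pi.single_apply, Pi.single_apply]
      split_ifs <;> ring
    simp only [h1, sum_add_distrib]
    rw [sum_comm (f := fun j k => if j = l then halfCot θ j k / 2 else 0)]
    simp only [sum_ite_eq', mem_univ, if_true, ← sum_div]
    ring
  simp only [_root_.smul_apply, _root_.sum_apply, smul_eq_mul, h]

variable {ψ : (Fin n → ℝ) → ℝ}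

theorem pd_PhiCS_mul (κ : ℝ) (hθ : θ ∈ chamber n) (hψ : DifferentiableAt ℝ ψ θ) (l : Fin n) :
    pd n l (fun t => PhiCS n κ t * ψ t) θ
      = PhiCS n κ θ * (-1 / κ * ((∑ k, halfCot θ l k) * ψ θ) + pd n l ψ θ) := by
  rw [pd_mul (hasFDerivAt_PhiCS κ hθ).differentiableAt hψ, pd_PhiCS κ hθ]
  ring

theorem pd_pd_PhiCS_mul (κ : ℝ) (hψ : ContDiffOn ℝ 2 ψ (chamber n)) (hθ : θ ∈ chamber n)
    (l : Fin n) :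
    pd n l (pd n l (fun t => PhiCS n κ t * ψ t)) θ
      = PhiCS n κ θ * ((1 / κ ^ 2 * (∑ k, halfCot θ l k) ^ 2
            + 1 / (2 * κ) * ∑ k, invSinSq θ l k) * ψ θ
          - 2 / κ * (∑ k, halfCot θ l k) * pd n l ψ θ + pd n l (pd n l ψ) θ) := by
  have hC : ∀ t ∈ chamber n, ContDiffAt ℝ 2 ψ t := fun t ht =>
    hψ.contDiffAt ((isOpen_chamber n).mem_nhds ht)
  have hd : DifferentiableAt ℝ ψ θ := (hC θ hθ).differentiableAt two_ne_zero
  have hS := (hasFDerivAt_sum_halfCot hθ l).differentiableAt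
  have hev : pd n l (fun t => PhiCS n κ t * ψ t) =ᶠ[𝓝 θ]
      fun t => PhiCS n κ t * (-1 / κ * ((∑ k, halfCot t l k) * ψ t) + pd n l ψ t) := by
    filter_upwards [(isOpen_chamber n).mem_nhds hθ] with t ht
    exact pd_PhiCS_mul κ ht ((hC t ht).differentiableAt two_ne_zero) l
  have hp := differentiableAt_pd (hC θ hθ) l
  have hm := hS.fun_mul hd
  have hcm := hm.const_mul (-1 / κ)
  have hconst : pd n l (fun _ => -1 / κ) θ = 0 := by
    rw [(hasFDerivAt_const (-1 / κ) θ).pd_eq]; simp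
  rw [pd_congr hev, pd_PhiCS_mul κ hθ (hcm.fun_add hp), pd_add hcm hp,
    pd_mul (differentiableAt_const _) hm, hconst, pd_mul hS hd, pd_sum_halfCot hθ]
  ring

end Phi

theorem Lop_eq {n : ℕ} (κ : ℝ) (j : Fin n) (ψ : (Fin n → ℝ) → ℝ) (θ : Fin n → ℝ) :
    Lop n κ j ψ θ = κ / 2 * pd n j (pd n j ψ) θ
      + ∑ k, halfCot θ k j * pd n k ψ θ
      - (6 - κ) / (4 * κ) * ψ θ * ∑ k, invSinSq θ j k := by
  rw [Lop, sum_filter_of_ne, sum_sub_distrib, mul_sum, ← add_sub_assoc]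
  · congr 1
    refine sum_congr rfl fun k _ => ?_
    rw [← invSinSq_comm, invSinSq]
    ring
  · rintro k - h rfl
    simp at h

theorem Hcs_eq {n : ℕ} (β : ℝ) (ψ : (Fin n → ℝ) → ℝ) (θ : Fin n → ℝ) :
    Hcs n β ψ θ = 1 / 2 * (∑ j, pd n j (pd n j ψ) θ)
      - β * (β - 2) / 32 * (∑ j, ∑ k, invSinSq θ j k) * ψ θ := by
  rw [sum_sum_eq_two_mul_sum_lt _ (invSinSq_comm θ) (invSinSq_self θ), Hcs, ← mul_sum]
  have h : ∑ j, ∑ k ∈ univ.filter (fun k => j < k), ψ θ / sin ((θ j - θ k) / 2) ^ 2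
      = ψ θ * ∑ j, ∑ k ∈ univ.filter (fun k => j < k), invSinSq θ j k := by
    simp only [mul_sum, invSinSq, mul_one_div]
  rw [h]
  ring

theorem stmt7 (κ : ℝ) (hκ : 0 < κ) (n : ℕ) (hn : 1 ≤ n)
    (ψ : (Fin n → ℝ) → ℝ) (hψ : ContDiffOn ℝ 2 ψ (chamber n))
    (θ : Fin n → ℝ) (hθ : θ ∈ chamber n) :
    (∑ j, Lop n κ j (fun t => PhiCS n κ t * ψ t) θ)
      = PhiCS n κ θ *
          (κ * Hcs n (8 / κ) ψ θ
            + ((n : ℝ) * ((n : ℝ) ^ 2 - 1) / (6 * κ)) * ψ θ) := by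
  have hd : DifferentiableAt ℝ ψ θ :=
    (hψ.contDiffAt ((isOpen_chamber n).mem_nhds hθ)).differentiableAt two_ne_zero
  have hswap : ∑ j, ∑ k, halfCot θ k j * pd n k (fun t => PhiCS n κ t * ψ t) θ
      = ∑ l, (∑ k, halfCot θ l k) *
        (PhiCS n κ θ * (-1 / κ * ((∑ k, halfCot θ l k) * ψ θ) + pd n l ψ θ)) := by
    rw [sum_comm]
    refine sum_congr rfl fun l _ => ?_
    rw [sum_mul, pd_PhiCS_mul κ hθ hd]
  have hL : ∑ j, Lop n κ j (fun t => PhiCS n κ t * ψ t) θ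
      = PhiCS n κ θ * (κ / 2 * (∑ j, pd n j (pd n j ψ) θ)
        - 1 / (2 * κ) * ψ θ * (∑ j, (∑ k, halfCot θ j k) ^ 2)
        + (1 / 4 - (6 - κ) / (4 * κ)) * ψ θ * ∑ j, ∑ k, invSinSq θ j k) := by
    simp only [Lop_eq, sum_sub_distrib, sum_add_distrib]
    rw [hswap, ← sum_add_distrib, ← sum_sub_distrib]
    simp only [mul_sum (s := univ) (a := κ / 2),
      mul_sum (f := fun j => (∑ k, halfCot θ j k) ^ 2),
      mul_sum (f := fun j => ∑ k, invSinSq θ j k), ← sum_sub_distrib, ← sum_add_distrib]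
    rw [mul_sum]
    refine sum_congr rfl fun j _ => ?_
    rw [pd_pd_PhiCS_mul κ hψ hθ]
    field_simp
    ring
  rw [hL, sum_sq_sum_halfCot hθ, Hcs_eq]
  field_simp
  ring
end

section
/- Fix n ≥ 2 and write f_{jk}(θ) = cot((θ_j−θ_k)/2) for j ≠ k. On the phase space {(θ,p) ∈ ℝ^n × ℝ^n : sin((θ_j−θ_k)/2) ≠ 0 for all j ≠ k} define for each j the null vector Hamiltonian H_j(θ,p) = (1/2)p_j^2 − Σ_{k≠j}(p_j+p_k)·f_{jk}(θ) + Σ_{k≠j}Σ_{l≠j, l≠k} f_{jk}(θ)f_{jl}(θ) − 2Σ_{k≠j} f_{jk}(θ)^2, and define the Poisson bracket of two differentiable functions F,G of (θ,p) by {F,G} = Σ_{i=1}^n ( ∂F/∂p_i · ∂G/∂θ_i − ∂F/∂θ_i · ∂G/∂p_i ). Then for all j ≠ k and all (θ,p) in the phase space, {H_j, H_k}(θ,p) = (1/sin^2((θ_j−θ_k)/2))·( H_k(θ,p) − H_j(θ,p) ). -/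
open Finset

/-- `f_{jk}(θ) = cot((θ_j − θ_k)/2)`. -/
noncomputable def fjk (n : ℕ) (θ : Fin n → ℝ) (j k : Fin n) : ℝ :=
  Real.cos ((θ j - θ k) / 2) / Real.sin ((θ j - θ k) / 2)

/-- The null vector Hamiltonian `H_j`. -/
noncomputable def nvHam (n : ℕ) (j : Fin n) (θ p : Fin n → ℝ) : ℝ :=
  (1 / 2) * p j ^ 2
    - ∑ k ∈ univ.filter (fun k => k ≠ j), (p j + p k) * fjk n θ j k
    + ∑ k ∈ univ.filter (fun k => k ≠ j),
        ∑ l ∈ univ.filter (fun l => l ≠ j ∧ l ≠ k), fjk n θ j k * fjk n θ j l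
    - 2 * ∑ k ∈ univ.filter (fun k => k ≠ j), fjk n θ j k ^ 2

/-- The Poisson bracket `{F,G} = Σ_i (∂F/∂p_i·∂G/∂θ_i − ∂F/∂θ_i·∂G/∂p_i)`. -/
noncomputable def pbracket (n : ℕ) (F G : (Fin n → ℝ) → (Fin n → ℝ) → ℝ)
    (θ p : Fin n → ℝ) : ℝ :=
  ∑ i,
    (deriv (fun t => F θ (Function.update p i t)) (p i) *
        deriv (fun t => G (Function.update θ i t) p) (θ i)
      - deriv (fun t => F (Function.update θ i t) p) (θ i) *
        deriv (fun t => G θ (Function.update p i t)) (p i))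

/-- `1 / sin²((θ_a − θ_b)/2)`, which vanishes on the diagonal. -/
noncomputable def cscSq (n : ℕ) (θ : Fin n → ℝ) (a b : Fin n) : ℝ :=
  1 / Real.sin ((θ a - θ b) / 2) ^ 2

/-- The contribution of `f_{jk}` to `∂H_j/∂θ_k`. -/
noncomputable def pairForce (n : ℕ) (θ p : Fin n → ℝ) (j k : Fin n) : ℝ :=
  cscSq n θ j k / 2 * (-p j - p k + 2 * ∑ l, fjk n θ j l - 6 * fjk n θ j k)

lemma fjk_self (n : ℕ) (θ : Fin n → ℝ) (a : Fin n) : fjk n θ a a = 0 := by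
  simp [fjk]

lemma cscSq_self (n : ℕ) (θ : Fin n → ℝ) (a : Fin n) : cscSq n θ a a = 0 := by
  simp [cscSq]

lemma sin_half_sub_swap (x y : ℝ) : Real.sin ((y - x) / 2) = -Real.sin ((x - y) / 2) := by
  rw [← Real.sin_neg]; ring_nf

lemma cos_half_sub_swap (x y : ℝ) : Real.cos ((y - x) / 2) = Real.cos ((x - y) / 2) := by
  rw [← Real.cos_neg]; ring_nf

lemma fjk_swap (n : ℕ) (θ : Fin n → ℝ) (a b : Fin n) : fjk n θ b a = -fjk n θ a b := by
  rw [fjk, fjk, sin_half_sub_swap (θ a), cos_half_sub_swap (θ a), div_neg]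

lemma cscSq_swap (n : ℕ) (θ : Fin n → ℝ) (a b : Fin n) : cscSq n θ b a = cscSq n θ a b := by
  rw [cscSq, cscSq, sin_half_sub_swap (θ a), neg_sq]

lemma pairForce_self (n : ℕ) (θ p : Fin n → ℝ) (a : Fin n) : pairForce n θ p a a = 0 := by
  simp [pairForce, cscSq_self]

lemma nvHam_eq_sum (n : ℕ) (j : Fin n) (θ p : Fin n → ℝ) :
    nvHam n j θ p = (1 / 2) * p j ^ 2 - ∑ k, (p j + p k) * fjk n θ j k
      + (∑ k, fjk n θ j k) ^ 2 - 3 * ∑ k, fjk n θ j k ^ 2 := by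
  have drop (g : Fin n → ℝ) (hg : g j = 0) :
      ∑ k ∈ univ.filter (fun k => k ≠ j), g k = ∑ k, g k := by
    rw [sum_filter]
    refine sum_congr rfl fun k _ => ?_
    split_ifs with h
    · rfl
    · rw [not_not.mp h, hg]
  have inner (k : Fin n) :
      ∑ l ∈ univ.filter (fun l => l ≠ j ∧ l ≠ k), fjk n θ j k * fjk n θ j l
        = fjk n θ j k * ∑ l, fjk n θ j l - fjk n θ j k ^ 2 := by
    rw [sum_filter, mul_sum, ← Fintype.sum_ite_eq' k fun _ => fjk n θ j k ^ 2,
      ← sum_sub_distrib]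
    refine sum_congr rfl fun l _ => ?_
    rcases eq_or_ne l k with rfl | hlk
    · simp [sq]
    rcases eq_or_ne l j with rfl | hlj
    · simp [hlk, fjk_self]
    · simp [hlk, hlj]
  rw [nvHam, drop _ (by simp [fjk_self]), drop _ (by simp [fjk_self]),
    drop _ (by simp [fjk_self])]
  simp only [inner, sum_sub_distrib, ← sum_mul]
  ring

lemma hasDerivAt_fjk (n : ℕ) (θ : Fin n → ℝ) (i a b : Fin n)
    (hab : a ≠ b → Real.sin ((θ a - θ b) / 2) ≠ 0) :
    HasDerivAt (fun t => fjk n (Function.update θ i t) a b)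
      (cscSq n θ a b / 2 * ((if i = b then 1 else 0) - (if i = a then 1 else 0))) (θ i) := by
  rcases eq_or_ne a b with rfl | h
  · simpa only [fjk_self, sub_self, mul_zero] using hasDerivAt_const (θ i) (0 : ℝ)
  have coord (c : Fin n) : HasDerivAt (fun t => Function.update θ i t c)
      (if i = c then 1 else 0) (θ i) := by
    rcases eq_or_ne i c with rfl | hc
    · simpa using hasDerivAt_id' (θ i)
    · simpa [hc, hc.symm] using hasDerivAt_const (θ i) (θ c)
  have hd := ((coord a).sub (coord b)).div_const 2
  have hs : Real.sin ((θ a - θ b) / 2) ≠ 0 := hab h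
  have hq := hd.cos.div hd.sin (by simpa using hs)
  refine hq.congr_deriv ?_
  simp only [Pi.sub_apply, Function.update_eq_self, cscSq]
  field_simp
  linear_combination ((if i = b then 1 else 0) - (if i = a then 1 else 0)) *
    Real.sin_sq_add_cos_sq ((θ a - θ b) / 2)

lemma deriv_nvHam_momentum (n : ℕ) (j i : Fin n) (θ p : Fin n → ℝ) :
    deriv (fun t => nvHam n j θ (Function.update p i t)) (p i)
      = (if i = j then p j - ∑ k, fjk n θ j k else 0) - fjk n θ j i := by
  have coord (c : Fin n) : HasDerivAt (fun t => Function.update p i t c)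
      (if i = c then 1 else 0) (p i) := by
    rcases eq_or_ne i c with rfl | hc
    · simpa using hasDerivAt_id' (p i)
    · simpa [hc, hc.symm] using hasDerivAt_const (p i) (p c)
  have hsum := HasDerivAt.fun_sum (u := univ) fun k _ =>
    ((coord j).fun_add (coord k)).mul_const (fjk n θ j k)
  simp only [nvHam_eq_sum]
  have := (((((coord j).fun_pow 2).const_mul (1 / 2)).fun_sub hsum).add_const
    ((∑ k, fjk n θ j k) ^ 2)).sub_const (3 * ∑ k, fjk n θ j k ^ 2)
  rw [this.deriv]
  simp only [add_mul, sum_add_distrib, ite_mul, one_mul, zero_mul, sum_ite_eq,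
    mem_univ, if_true, Function.update_eq_self]
  split_ifs
  all_goals norm_num
  ring

lemma deriv_nvHam_position (n : ℕ) (j i : Fin n) (θ p : Fin n → ℝ)
    (hθ : ∀ a b : Fin n, a ≠ b → Real.sin ((θ a - θ b) / 2) ≠ 0) :
    deriv (fun t => nvHam n j (Function.update θ i t) p) (θ i)
      = pairForce n θ p j i - (if i = j then ∑ k, pairForce n θ p j k else 0) := by
  have hf (k : Fin n) := hasDerivAt_fjk n θ i j k (hθ j k)
  have hlin := HasDerivAt.fun_sum (u := univ) fun k _ => (hf k).const_mul (p j + p k)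
  have hsum := HasDerivAt.fun_sum (u := univ) fun k _ => hf k
  have hsq := HasDerivAt.fun_sum (u := univ) fun k _ => (hf k).fun_pow 2
  simp only [nvHam_eq_sum]
  have := (((hlin.const_sub ((1 / 2) * p j ^ 2)).fun_add (hsum.fun_pow 2)).fun_sub
    (hsq.const_mul 3))
  rw [this.deriv]
  have hR : pairForce n θ p j i - (if i = j then ∑ k, pairForce n θ p j k else 0)
      = ∑ k, pairForce n θ p j k *
        ((if i = k then 1 else 0) - (if i = j then 1 else 0)) := by
    simp only [mul_sub, sum_sub_distrib, mul_ite, mul_one, mul_zero, sum_ite_eq, mem_univ,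
      if_true]
    split_ifs <;> simp
  rw [hR]
  simp only [Function.update_eq_self]
  rw [mul_sum, mul_sum, ← sum_neg_distrib, ← sum_add_distrib, ← sum_sub_distrib]
  refine sum_congr rfl fun k _ => ?_
  rw [pairForce]
  push_cast
  ring

lemma fjk_sub_mul_cscSq (n : ℕ) (θ : Fin n → ℝ) {i j k : Fin n}
    (hθ : ∀ a b : Fin n, a ≠ b → Real.sin ((θ a - θ b) / 2) ≠ 0)
    (hij : i ≠ j) (hik : i ≠ k) (hjk : j ≠ k) :
    (fjk n θ j k - fjk n θ j i) * cscSq n θ k i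
      = cscSq n θ j k * (fjk n θ k i - fjk n θ j i) := by
  have h1 := hθ j k hjk
  have h2 := hθ j i hij.symm
  have h3 := hθ k i hik.symm
  have e : (θ j - θ i) / 2 = (θ j - θ k) / 2 + (θ k - θ i) / 2 := by ring
  simp only [fjk, cscSq]
  rw [e] at h2 ⊢
  generalize (θ j - θ k) / 2 = x at *
  generalize (θ k - θ i) / 2 = y at *
  field_simp
  rw [Real.sin_add, Real.cos_add]
  linear_combination (Real.sin y * Real.sin x) * Real.sin_sq_add_cos_sq x -
    (Real.sin y * Real.sin x) * Real.sin_sq_add_cos_sq y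

lemma exchange_term (n : ℕ) (θ p : Fin n → ℝ) {j k : Fin n}
    (hθ : ∀ a b : Fin n, a ≠ b → Real.sin ((θ a - θ b) / 2) ≠ 0) (hjk : j ≠ k) (i : Fin n) :
    (fjk n θ j k - fjk n θ j i) * pairForce n θ p k i
        + (fjk n θ k i - fjk n θ k j) * pairForce n θ p j i
      = cscSq n θ j k / 2 * ((fjk n θ k i - fjk n θ j i) *
          (-p j - p k - 2 * p i + 2 * ∑ l, fjk n θ k l + 2 * ∑ l, fjk n θ j l
            - 6 * fjk n θ k i - 6 * fjk n θ j i))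
        + (if i = j then fjk n θ j k * pairForce n θ p k j
            + cscSq n θ j k / 2 * (fjk n θ j k * (-3 * p j - p k + 2 * ∑ l, fjk n θ k l
              + 2 * ∑ l, fjk n θ j l + 6 * fjk n θ j k)) else 0)
        + (if i = k then fjk n θ j k * pairForce n θ p j k
            + cscSq n θ j k / 2 * (fjk n θ j k * (-p j - 3 * p k + 2 * ∑ l, fjk n θ k l
              + 2 * ∑ l, fjk n θ j l - 6 * fjk n θ j k)) else 0) := by
  rcases eq_or_ne i j with rfl | hij
  · simp only [if_true, if_neg hjk, pairForce_self, fjk_self, fjk_swap n θ i k]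
    ring
  rcases eq_or_ne i k with rfl | hik
  · simp only [if_true, if_neg hij, pairForce_self, fjk_self, fjk_swap n θ j i]
    ring
  have h1 := fjk_sub_mul_cscSq n θ hθ hij hik hjk
  have h2 := fjk_sub_mul_cscSq n θ hθ hik hij hjk.symm
  rw [cscSq_swap n θ j k] at h2
  simp only [if_neg hij, if_neg hik, pairForce]
  linear_combination (-p k - p i + 2 * ∑ l, fjk n θ k l - 6 * fjk n θ k i) / 2 * h1
    - (-p j - p i + 2 * ∑ l, fjk n θ j l - 6 * fjk n θ j i) / 2 * h2

theorem stmt10 (n : ℕ) (hn : 2 ≤ n) (j k : Fin n) (hjk : j ≠ k)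
    (θ p : Fin n → ℝ)
    (hθ : ∀ a b : Fin n, a ≠ b → Real.sin ((θ a - θ b) / 2) ≠ 0) :
    pbracket n (nvHam n j) (nvHam n k) θ p
      = (1 / Real.sin ((θ j - θ k) / 2) ^ 2) * (nvHam n k θ p - nvHam n j θ p) := by
  have hbracket : pbracket n (nvHam n j) (nvHam n k) θ p
      = (p j - ∑ l, fjk n θ j l) * pairForce n θ p k j
        - (p k - ∑ l, fjk n θ k l) * pairForce n θ p j k
        + ∑ i, ((fjk n θ j k - fjk n θ j i) * pairForce n θ p k i
          + (fjk n θ k i - fjk n θ k j) * pairForce n θ p j i) := by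
    simp only [pbracket, deriv_nvHam_momentum, deriv_nvHam_position n _ _ θ p hθ]
    simp only [sub_mul, mul_sub, ite_mul, mul_ite, zero_mul, mul_zero, sum_sub_distrib,
      sum_add_distrib, sum_ite_eq', mem_univ, if_true, ← mul_sum, if_neg hjk.symm]
    simp only [mul_comm (pairForce n θ p j _)]
    ring
  change _ = cscSq n θ j k * _
  rw [hbracket, sum_congr rfl fun i _ => exchange_term n θ p hθ hjk i]
  simp only [sum_add_distrib, sum_ite_eq', mem_univ, if_true, ← mul_sum]
  have hsum (c d : ℝ) : ∑ i, (fjk n θ k i - fjk n θ j i) *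
          (-p j - p k - 2 * p i + 2 * c + 2 * d - 6 * fjk n θ k i - 6 * fjk n θ j i)
      = (∑ l, fjk n θ k l - ∑ l, fjk n θ j l) * (-p j - p k + 2 * c + 2 * d)
        - 2 * (∑ l, p l * fjk n θ k l - ∑ l, p l * fjk n θ j l)
        - 6 * (∑ l, fjk n θ k l ^ 2 - ∑ l, fjk n θ j l ^ 2) := by
    rw [← sum_sub_distrib, ← sum_sub_distrib, ← sum_sub_distrib, sum_mul, mul_sum, mul_sum,
      ← sum_sub_distrib, ← sum_sub_distrib]
    exact sum_congr rfl fun i _ => by ring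
  rw [hsum, nvHam_eq_sum, nvHam_eq_sum]
  simp only [add_mul, sum_add_distrib, ← mul_sum, pairForce, cscSq_swap n θ j k, fjk_swap n θ j k]
  ring
end

section
/- Let I ⊆ ℝ be an open interval, m ≥ 1, and let ζ_1,…,ζ_m : I → ℂ be differentiable functions such that sin((ζ_k(t)−ζ_l(t))/2) ≠ 0 for all k ≠ l and t ∈ I, and such that for every k and t the derivative satisfies ζ_k'(t) = 2 Σ_{l≠k} cot((ζ_k(t)−ζ_l(t))/2). Then each ζ_k is twice differentiable on I and satisfies the Calogero–Sutherland equation ζ_k''(t) = −4 Σ_{l≠k} cos((ζ_k(t)−ζ_l(t))/2)/sin^3((ζ_k(t)−ζ_l(t))/2). -/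
open Finset

theorem Complex.hasDerivAt_cos_div_sin {x : ℂ} (hx : Complex.sin x ≠ 0) :
    HasDerivAt (fun z => Complex.cos z / Complex.sin z) (-(1 / Complex.sin x ^ 2)) x := by
  refine ((Complex.hasDerivAt_cos x).fun_div (Complex.hasDerivAt_sin x) hx).congr_deriv ?_
  rw [← neg_div]
  congr 1
  linear_combination -Complex.sin_sq_add_cos_sq x

theorem Finset.sum_sum_eq_zero_of_antisymm {ι : Type*} (s : Finset ι) (f : ι → ι → ℂ)
    (hf : ∀ i j, f i j = -f j i) : ∑ i ∈ s, ∑ j ∈ s, f i j = 0 := by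
  have h : ∑ i ∈ s, ∑ j ∈ s, f i j = -∑ i ∈ s, ∑ j ∈ s, f i j := by
    conv_lhs => rw [sum_comm]
    simp only [← sum_neg_distrib]
    exact sum_congr rfl fun i _ => sum_congr rfl fun j _ => hf j i
  exact self_eq_neg.mp h

/-- The difference of two cotangents sharing an argument, including the degenerate cases, in
which division by zero yields zero. -/
theorem cot_sub_cot_div_sin_sq {ι : Type*} [DecidableEq ι] (z : ι → ℂ)
    (hz : ∀ i j, i ≠ j → Complex.sin ((z i - z j) / 2) ≠ 0) (k l j : ι) :
    1 / Complex.sin ((z k - z l) / 2) ^ 2 *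
        (Complex.cos ((z k - z j) / 2) / Complex.sin ((z k - z j) / 2) -
          Complex.cos ((z l - z j) / 2) / Complex.sin ((z l - z j) / 2)) =
      (if j = k then Complex.cos ((z k - z l) / 2) / Complex.sin ((z k - z l) / 2) ^ 3 else 0) +
        (if j = l then Complex.cos ((z k - z l) / 2) / Complex.sin ((z k - z l) / 2) ^ 3 else 0) -
        1 / (Complex.sin ((z k - z l) / 2) * Complex.sin ((z k - z j) / 2) *
          Complex.sin ((z l - z j) / 2)) := by
  by_cases hkl : k = l
  · subst hkl
    simp
  have h1 := hz k l hkl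
  by_cases hjk : j = k
  · subst hjk
    have h : (z l - z j) / 2 = -((z j - z l) / 2) := by ring
    rw [h, Complex.cos_neg, Complex.sin_neg]
    simp [hkl]
    field_simp
  by_cases hjl : j = l
  · subst hjl
    simp [hjk]
    field_simp
  have h2 := hz k j (Ne.symm hjk)
  have h3 := hz l j (Ne.symm hjl)
  have h : Complex.sin ((z k - z l) / 2) =
      Complex.sin ((z k - z j) / 2) * Complex.cos ((z l - z j) / 2) -
        Complex.cos ((z k - z j) / 2) * Complex.sin ((z l - z j) / 2) := by
    rw [← Complex.sin_sub]
    congr 1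
    ring
  simp only [hjk, hjl, if_false]
  field_simp
  linear_combination h

theorem sum_cot_sub_cot_div_sin_sq {ι : Type*} [Fintype ι] [DecidableEq ι] (z : ι → ℂ)
    (hz : ∀ i j, i ≠ j → Complex.sin ((z i - z j) / 2) ≠ 0) (k : ι) :
    ∑ l, 1 / Complex.sin ((z k - z l) / 2) ^ 2 *
        (∑ j, Complex.cos ((z k - z j) / 2) / Complex.sin ((z k - z j) / 2) -
          ∑ j, Complex.cos ((z l - z j) / 2) / Complex.sin ((z l - z j) / 2)) =
      2 * ∑ l, Complex.cos ((z k - z l) / 2) / Complex.sin ((z k - z l) / 2) ^ 3 := by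
  have h0 : ∑ l, ∑ j, 1 / (Complex.sin ((z k - z l) / 2) * Complex.sin ((z k - z j) / 2) *
      Complex.sin ((z l - z j) / 2)) = 0 := by
    refine sum_sum_eq_zero_of_antisymm _ _ fun l j => ?_
    have h : (z l - z j) / 2 = -((z j - z l) / 2) := by ring
    rw [h, Complex.sin_neg, mul_neg, div_neg, mul_comm (Complex.sin ((z k - z l) / 2))]
  simp only [← sum_sub_distrib, mul_sum, cot_sub_cot_div_sin_sq z hz k]
  simp only [sum_sub_distrib, h0, sum_add_distrib, sum_ite_eq', mem_univ, if_true, sub_zero]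
  rw [← mul_sum]
  ring

theorem stmt14 (m : ℕ) (hm : 1 ≤ m)
    (I : Set ℝ) (hI : IsOpen I) (hI' : Convex ℝ I)
    (ζ : Fin m → ℝ → ℂ)
    (hsin : ∀ k l : Fin m, k ≠ l → ∀ t ∈ I,
      Complex.sin ((ζ k t - ζ l t) / 2) ≠ 0)
    (hode : ∀ k : Fin m, ∀ t ∈ I,
      HasDerivAt (ζ k)
        (2 * ∑ l ∈ univ.filter (fun l => l ≠ k),
          Complex.cos ((ζ k t - ζ l t) / 2) / Complex.sin ((ζ k t - ζ l t) / 2)) t) :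
    ∀ k : Fin m, ∀ t ∈ I,
      HasDerivAt (deriv (ζ k))
        (-4 * ∑ l ∈ univ.filter (fun l => l ≠ k),
          Complex.cos ((ζ k t - ζ l t) / 2) / Complex.sin ((ζ k t - ζ l t) / 2) ^ 3) t := by
  intro k t ht
  have hderiv : deriv (ζ k) =ᶠ[nhds t] fun s => 2 * ∑ l ∈ univ.filter (fun l => l ≠ k),
      Complex.cos ((ζ k s - ζ l s) / 2) / Complex.sin ((ζ k s - ζ l s) / 2) := by
    filter_upwards [hI.mem_nhds ht] with s hs using (hode k s hs).deriv
  refine HasDerivAt.congr_of_eventuallyEq ?_ hderiv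
  have hfilter : ∀ (i : Fin m) (f : Fin m → ℂ), f i = 0 →
      ∑ l ∈ univ.filter (fun l => l ≠ i), f l = ∑ l, f l := fun i f hf =>
    sum_filter_of_ne fun l _ hl h => hl (h ▸ hf)
  have hode' : ∀ i, HasDerivAt (ζ i)
      (2 * ∑ j, Complex.cos ((ζ i t - ζ j t) / 2) / Complex.sin ((ζ i t - ζ j t) / 2)) t := by
    intro i
    rw [← hfilter i _ (by simp)]
    exact hode i t ht
  have hsum := HasDerivAt.fun_sum (u := univ.filter (fun l => l ≠ k)) fun l hl =>
    (Complex.hasDerivAt_cos_div_sin (hsin k l (mem_filter.mp hl).2.symm t ht)).comp t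
      (((hode' k).sub (hode' l)).div_const 2)
  refine (hsum.const_mul 2).congr_deriv ?_
  rw [hfilter k _ (by simp), hfilter k _ (by simp)]
  have key := sum_cot_sub_cot_div_sin_sq (fun i => ζ i t) (fun i j hij => hsin i j hij t ht) k
  rw [show (-4 : ℂ) = -2 * 2 by norm_num, mul_assoc, ← key]
  trans ∑ l, (-2 : ℂ) * (1 / Complex.sin ((ζ k t - ζ l t) / 2) ^ 2 *
    (∑ j, Complex.cos ((ζ k t - ζ j t) / 2) / Complex.sin ((ζ k t - ζ j t) / 2) -
      ∑ j, Complex.cos ((ζ l t - ζ j t) / 2) / Complex.sin ((ζ l t - ζ j t) / 2)))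
  · rw [mul_sum univ _ (2 : ℂ)]
    exact sum_congr rfl fun l _ => by ring
  · rw [← mul_sum]
end

section
/- Let I ⊆ ℝ be an interval, n ≥ 1, m ≥ 0, fix an index j ∈ {1,…,n}, and let z_1,…,z_n, ξ_1,…,ξ_m, g, w : I → ℂ be differentiable functions such that at every t ∈ I the values z_1(t),…,z_n(t), ξ_1(t),…,ξ_m(t), g(t) are pairwise distinct, nonzero, and w(t) ≠ 0, and such that the radial Loewner ODEs for growth at z_j hold: z_j' = z_j·[Σ_{k≠j}(z_j+z_k)/(z_k−z_j) − 2Σ_{l=1}^m (z_j+ξ_l)/(ξ_l−z_j)]; z_k' = z_k·(z_j+z_k)/(z_j−z_k) for every k ≠ j; ξ_l' = ξ_l·(z_j+ξ_l)/(z_j−ξ_l) for every l; g' = g·(z_j+g)/(z_j−g); and w' = w·[(z_j+g)/(z_j−g) + 2 z_j g/(z_j−g)^2]. Then the function N(t) = e^{−(2m−n)t} · (∏_{l=1}^m ξ_l(t)^2 / ∏_{k=1}^n z_k(t)) · g(t)^{2m−n−2} · w(t)^2 · ∏_{k=1}^n (g(t)−z_k(t))^2 / ∏_{l=1}^m (g(t)−ξ_l(t))^4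 is constant on I. -/
open Finset

/-- The field integral of motion `N_t(z)` for the multiple radial SLE(0) Loewner flow,
where `g` is the Loewner map at a fixed point and `w` its spatial derivative. -/
noncomputable def Nfun (n m : ℕ) (z : Fin n → ℝ → ℂ) (ξ : Fin m → ℝ → ℂ)
    (g w : ℝ → ℂ) (t : ℝ) : ℂ :=
  Complex.exp (-(2 * (m : ℂ) - (n : ℂ)) * (t : ℂ))
    * ((∏ l, ξ l t ^ 2) / (∏ k, z k t))
    * g t ^ (2 * (m : ℤ) - (n : ℤ) - 2) * w t ^ 2
    * (∏ k, (g t - z k t) ^ 2) / (∏ l, (g t - ξ l t) ^ 4)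

namespace HasDerivAt

/-! Rules for derivatives written in logarithmic form, as the function times a factor. -/

variable {f g : ℝ → ℂ} {a b : ℂ} {t : ℝ}

lemma mul_logForm (hf : HasDerivAt f (f t * a) t) (hg : HasDerivAt g (g t * b) t) :
    HasDerivAt (fun s => f s * g s) (f t * g t * (a + b)) t :=
  (hf.fun_mul hg).congr_deriv (by ring)

lemma div_logForm (hf : HasDerivAt f (f t * a) t) (hg : HasDerivAt g (g t * b) t)
    (h0 : g t ≠ 0) : HasDerivAt (fun s => f s / g s) (f t / g t * (a - b)) t :=
  (hf.fun_div hg h0).congr_deriv (by field_simp)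

lemma zpow_logForm (hf : HasDerivAt f (f t * a) t) (h0 : f t ≠ 0) (p : ℤ) :
    HasDerivAt (fun s => f s ^ p) (f t ^ p * (p * a)) t := by
  refine ((hasDerivAt_zpow p (f t) (Or.inl h0)).comp t hf).congr_deriv ?_
  rw [zpow_sub_one₀ h0]
  field_simp

lemma pow_logForm (hf : HasDerivAt f (f t * a) t) (h0 : f t ≠ 0) (p : ℕ) :
    HasDerivAt (fun s => f s ^ p) (f t ^ p * (p * a)) t := by
  simpa using hf.zpow_logForm h0 (p : ℤ)

lemma finset_prod_logForm {ι : Type*} {F : ι → ℝ → ℂ} {A : ι → ℂ} (u : Finset ι)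
    (h : ∀ i ∈ u, HasDerivAt (F i) (F i t * A i) t) :
    HasDerivAt (fun s => ∏ i ∈ u, F i s) ((∏ i ∈ u, F i t) * ∑ i ∈ u, A i) t := by
  classical
  induction u using Finset.induction_on with
  | empty => simpa using hasDerivAt_const t (1 : ℂ)
  | insert i u hi ih =>
    simp only [Finset.prod_insert hi, Finset.sum_insert hi]
    exact (h i (Finset.mem_insert_self i u)).mul_logForm
      (ih fun k hk => h k (Finset.mem_insert_of_mem hk))

end HasDerivAt

/-- The difference of two solutions of the radial Loewner equation driven by `x`. -/
lemma hasDerivAt_sub_radial {f g : ℝ → ℂ} {t : ℝ} {x : ℂ}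
    (hf : HasDerivAt f (f t * (x + f t) / (x - f t)) t)
    (hg : HasDerivAt g (g t * (x + g t) / (x - g t)) t)
    (hxf : x - f t ≠ 0) (hxg : x - g t ≠ 0) :
    HasDerivAt (fun s => g s - f s) ((g t - f t) *
      (((x + g t) / (x - g t) * ((x + f t) / (x - f t)) + (x + g t) / (x - g t)
        + (x + f t) / (x - f t) - 1) / 2)) t := by
  refine (hg.fun_sub hf).congr_deriv ?_
  field_simp
  ring

/-- The difference of a solution of the radial Loewner equation and its driving function. -/
lemma hasDerivAt_sub_driving {x g : ℝ → ℂ} {t : ℝ} {S : ℂ}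
    (hx : HasDerivAt x (x t * S) t)
    (hg : HasDerivAt g (g t * (x t + g t) / (x t - g t)) t)
    (hxg : x t - g t ≠ 0) :
    HasDerivAt (fun s => g s - x s) ((g t - x t) *
      ((-((x t + g t) / (x t - g t) - 1) * ((x t + g t) / (x t - g t))
        + ((x t + g t) / (x t - g t) + 1) * S) / 2)) t := by
  refine (hg.fun_sub hx).congr_deriv ?_
  field_simp
  ring

theorem stmt15 (n m : ℕ) (hn : 1 ≤ n) (j : Fin n)
    (I : Set ℝ) (hI : Convex ℝ I)
    (z : Fin n → ℝ → ℂ) (ξ : Fin m → ℝ → ℂ) (g w : ℝ → ℂ)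
    (hzz : ∀ t ∈ I, ∀ i k : Fin n, i ≠ k → z i t ≠ z k t)
    (hξξ : ∀ t ∈ I, ∀ k l : Fin m, k ≠ l → ξ k t ≠ ξ l t)
    (hzξ : ∀ t ∈ I, ∀ (i : Fin n) (l : Fin m), z i t ≠ ξ l t)
    (hgz : ∀ t ∈ I, ∀ i : Fin n, g t ≠ z i t)
    (hgξ : ∀ t ∈ I, ∀ l : Fin m, g t ≠ ξ l t)
    (hz0 : ∀ t ∈ I, ∀ i : Fin n, z i t ≠ 0)
    (hξ0 : ∀ t ∈ I, ∀ l : Fin m, ξ l t ≠ 0)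
    (hg0 : ∀ t ∈ I, g t ≠ 0)
    (hw0 : ∀ t ∈ I, w t ≠ 0)
    (hzj : ∀ t ∈ I, HasDerivAt (z j)
      (z j t * ((∑ k ∈ univ.filter (fun k => k ≠ j), (z j t + z k t) / (z k t - z j t))
        - 2 * ∑ l, (z j t + ξ l t) / (ξ l t - z j t))) t)
    (hzk : ∀ k : Fin n, k ≠ j → ∀ t ∈ I,
      HasDerivAt (z k) (z k t * (z j t + z k t) / (z j t - z k t)) t)
    (hξl : ∀ l : Fin m, ∀ t ∈ I,
      HasDerivAt (ξ l) (ξ l t * (z j t + ξ l t) / (z j t - ξ l t)) t)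
    (hg : ∀ t ∈ I, HasDerivAt g (g t * (z j t + g t) / (z j t - g t)) t)
    (hw : ∀ t ∈ I, HasDerivAt w
      (w t * ((z j t + g t) / (z j t - g t)
        + 2 * z j t * g t / (z j t - g t) ^ 2)) t) :
    ∀ s ∈ I, ∀ t ∈ I, Nfun n m z ξ g w s = Nfun n m z ξ g w t := by
  have hderiv : ∀ t ∈ I, HasDerivAt (Nfun n m z ξ g w) 0 t := by
    intro t ht
    have hxg : z j t - g t ≠ 0 := sub_ne_zero.2 (hgz t ht j).symm
    have hxz : ∀ k, k ≠ j → z j t - z k t ≠ 0 :=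
      fun k hk => sub_ne_zero.2 (hzz t ht j k hk.symm)
    have hxξ : ∀ l, z j t - ξ l t ≠ 0 := fun l => sub_ne_zero.2 (hzξ t ht j l)
    set x := z j t with hx
    set c : ℂ → ℂ := fun a => (x + a) / (x - a) with hc
    set V := ∑ k ∈ univ.erase j, c (z k t) with hV
    set Y := ∑ l, c (ξ l t) with hY
    have hxderiv : HasDerivAt (z j) (z j t * (-V + 2 * Y)) t := by
      refine (hzj t ht).congr_deriv ?_
      have hneg : ∀ a : ℂ, (x + a) / (a - x) = -c a := fun a => by
        rw [hc, ← neg_sub x a, div_neg]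
      simp only [← hx, hneg, Finset.sum_neg_distrib, Finset.filter_ne', ← hV, ← hY]
      ring
    have hzderiv : ∀ k, HasDerivAt (z k)
        (z k t * (if k = j then -V + 2 * Y else c (z k t))) t := by
      intro k
      split_ifs with h
      · exact h ▸ hxderiv
      · exact (hzk k h t ht).congr_deriv (mul_div_assoc _ _ _)
    have hξderiv : ∀ l, HasDerivAt (ξ l) (ξ l t * c (ξ l t)) t :=
      fun l => (hξl l t ht).congr_deriv (mul_div_assoc _ _ _)
    have hgderiv : HasDerivAt g (g t * c (g t)) t :=
      (hg t ht).congr_deriv (mul_div_assoc _ _ _)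
    have hgzderiv : ∀ k, HasDerivAt (fun s => g s - z k s) ((g t - z k t) *
        (if k = j then (-(c (g t) - 1) * c (g t) + (c (g t) + 1) * (-V + 2 * Y)) / 2
          else (c (g t) * c (z k t) + c (g t) + c (z k t) - 1) / 2)) t := by
      intro k
      split_ifs with h
      · subst h
        exact hasDerivAt_sub_driving hxderiv (hg t ht) hxg
      · exact hasDerivAt_sub_radial (hzk k h t ht) (hg t ht) (hxz k h) hxg
    have hgξderiv : ∀ l, HasDerivAt (fun s => g s - ξ l s) ((g t - ξ l t) *
        ((c (g t) * c (ξ l t) + c (g t) + c (ξ l t) - 1) / 2)) t :=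
      fun l => hasDerivAt_sub_radial (hξl l t ht) (hg t ht) (hxξ l) hxg
    have hexp : HasDerivAt (fun s : ℝ => Complex.exp (-(2 * (m : ℂ) - (n : ℂ)) * (s : ℂ)))
        (Complex.exp (-(2 * (m : ℂ) - (n : ℂ)) * (t : ℂ)) * (-(2 * (m : ℂ) - (n : ℂ)))) t := by
      simpa using ((hasDerivAt_id t).ofReal_comp.const_mul (-(2 * (m : ℂ) - (n : ℂ)))).cexp
    have hN := (((((hexp.mul_logForm
      ((HasDerivAt.finset_prod_logForm univ
          fun l _ => (hξderiv l).pow_logForm (hξ0 t ht l) 2).div_logForm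
        (HasDerivAt.finset_prod_logForm univ fun k _ => hzderiv k)
        (Finset.prod_ne_zero_iff.2 fun k _ => hz0 t ht k))).mul_logForm
      (hgderiv.zpow_logForm (hg0 t ht) (2 * (m : ℤ) - (n : ℤ) - 2))).mul_logForm
      ((hw t ht).pow_logForm (hw0 t ht) 2)).mul_logForm
      (HasDerivAt.finset_prod_logForm univ
        fun k _ => (hgzderiv k).pow_logForm (sub_ne_zero.2 (hgz t ht k)) 2)).div_logForm
      (HasDerivAt.finset_prod_logForm univ
        fun l _ => (hgξderiv l).pow_logForm (sub_ne_zero.2 (hgξ t ht l)) 4)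
      (Finset.prod_ne_zero_iff.2
        fun l _ => pow_ne_zero 4 (sub_ne_zero.2 (hgξ t ht l))))
    refine hN.congr_deriv (mul_eq_zero_of_right _ ?_)
    have hsplit : ∀ (p : ℂ) (q : Fin n → ℂ),
        ∑ k, (if k = j then p else q k) = p + ∑ k ∈ univ.erase j, q k := by
      intro p q
      rw [← Finset.add_sum_erase univ _ (Finset.mem_univ j), if_pos rfl]
      congr 1
      exact Finset.sum_congr rfl fun k hk => if_neg (Finset.ne_of_mem_erase hk)
    have hcard : (((univ.erase j).card : ℕ) : ℂ) = n - 1 := by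
      rw [Finset.card_erase_of_mem (Finset.mem_univ j), Finset.card_univ, Fintype.card_fin,
        Nat.cast_sub hn, Nat.cast_one]
    have hwcoef : 2 * z j t * g t / (z j t - g t) ^ 2 = (c (g t) ^ 2 - 1) / 2 := by
      simp only [hc, ← hx]
      field_simp
      ring
    simp only [← Finset.mul_sum, hsplit, ← Finset.sum_div, Finset.sum_sub_distrib,
      Finset.sum_add_distrib, Finset.sum_const, nsmul_eq_mul, hcard, Finset.card_univ,
      Fintype.card_fin, ← hV, ← hY, hwcoef]
    push_cast
    change _ + _ + _ + 2 * (c (g t) + _) + _ - _ = (0 : ℂ)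
    ring
  intro s hs t ht
  have h := hI.norm_image_sub_le_of_norm_hasDerivWithin_le (C := 0)
    (fun u hu => (hderiv u hu).hasDerivWithinAt) (fun _ _ => norm_zero.le) ht hs
  rwa [zero_mul, norm_le_zero_iff, sub_eq_zero] at h
end
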